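/- arXiv:1501.02733 — 5 statements merged into one kernel-verified Lean document; each statement's English description precedes it below -/
import Mathlib

section
/- Spectrum of the partial transpose of an entangled pure state: let r ≥ 1, let λ_1,…,λ_r be strictly positive reals with Σ_k λ_k² = 1, let e_1,…,e_r be an orthonormal family in ℂ^m and f_1,…,f_r an orthonormal family in ℂ^n, and let ψ(i,μ) = Σ_k λ_k e_k(i) f_k(μ). Then the partial transpose (ψψ†)^{T_A} of the projector onto ψ is Hermitian and its eigenvalues, counted with multiplicity, are: λ_k² for each k = 1,…,r; +λ_k λ_l and −λ_k λ_l for each pair k < l; and 0 with multiplicity mn − r². In particular, if r ≥ 2 then (ψψ†)^{T_A} has exactly r(r−1)/2 negative eigenvalues and is not positive semidefinite. -/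
open scoped ComplexOrder

section SwapDiagonal

variable {ι R : Type*} [LinearOrder ι]

/-- The matrix `x ↦ ((a, b) ↦ w (b, a) * x (b, a))`, a diagonal matrix followed by the flip. -/
def flipDiagonal [Zero R] (w : ι × ι → R) : Matrix (ι × ι) (ι × ι) R :=
  fun p q => if p.swap = q then w q else 0

variable [Fintype ι]

theorem flipDiagonal_mul_flipDiagonal [Semiring R] (v w : ι × ι → R) :
    flipDiagonal v * flipDiagonal w = Matrix.diagonal fun p => v p.swap * w p := by
  ext p q
  rw [Matrix.mul_apply, Finset.sum_eq_single p.swap]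
  · by_cases h : p = q <;> simp [flipDiagonal, h]
  · intro b _ hb
    simp [flipDiagonal, hb.symm]
  · simp

theorem flipDiagonal_mul_diagonal [Semiring R] (v w : ι × ι → R) :
    flipDiagonal v * Matrix.diagonal w = flipDiagonal fun p => v p * w p := by
  ext p q
  rw [Matrix.mul_diagonal]
  by_cases h : p.swap = q <;> simp [flipDiagonal, h]

/-- `w` on and above the diagonal of `ι × ι`, and `-w` below it. -/
def lowerNeg [Neg R] (w : ι × ι → R) (p : ι × ι) : R :=
  if p.1 ≤ p.2 then w p else -w p

/-- The sign of `p.2 - p.1`. -/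
def orderSign (R : Type*) [Ring R] (p : ι × ι) : R :=
  if p.1 < p.2 then 1 else if p.2 < p.1 then -1 else 0

theorem charpoly_flipDiagonal {K : Type*} [Field K] [CharZero K] (w : ι × ι → K)
    (hw : ∀ p, w p.swap = w p) :
    (flipDiagonal w).charpoly = (Matrix.diagonal (lowerNeg w)).charpoly := by
  set s : ι × ι → K := orderSign K with hs
  set S : Matrix (ι × ι) (ι × ι) K := 1 + flipDiagonal s with hS
  set T : Matrix (ι × ι) (ι × ι) K :=
    (1 - flipDiagonal s) * Matrix.diagonal (fun p => (1 + s p ^ 2)⁻¹) with hT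
  have hne : ∀ p, 1 + s p ^ 2 ≠ 0 := by
    intro p
    simp only [hs, orderSign]
    split_ifs <;> norm_num
  have hST : S * T = 1 := by
    have h : S * (1 - flipDiagonal s) = Matrix.diagonal fun p => 1 + s p ^ 2 := by
      have hsq : flipDiagonal s * flipDiagonal s = Matrix.diagonal fun p => -s p ^ 2 := by
        rw [flipDiagonal_mul_flipDiagonal]
        congr 1
        ext ⟨a, b⟩
        rcases lt_trichotomy a b with h | h | h <;>
          simp [hs, orderSign, h, not_lt_of_gt]
      have : S * (1 - flipDiagonal s) = 1 - flipDiagonal s * flipDiagonal s := by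
        rw [hS]; noncomm_ring
      rw [this, hsq, ← Matrix.diagonal_one, Matrix.diagonal_sub]
      simp
    rw [hT, ← mul_assoc, h, Matrix.diagonal_mul_diagonal, ← Matrix.diagonal_one]
    congr 1
    ext p
    exact mul_inv_cancel₀ (hne p)
  have hMS : flipDiagonal w * S = S * Matrix.diagonal (lowerNeg w) := by
    rw [hS, mul_add, add_mul, mul_one, one_mul, flipDiagonal_mul_flipDiagonal,
      flipDiagonal_mul_diagonal]
    ext ⟨a, b⟩ ⟨c, d⟩
    have h1 := hw (c, d)
    simp only [Prod.swap_prod_mk] at h1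
    simp only [Matrix.add_apply, flipDiagonal, Matrix.diagonal_apply, Prod.swap_prod_mk,
      Prod.mk.injEq]
    by_cases h : a = b
    · subst h
      by_cases h' : a = c ∧ a = d
      · obtain ⟨rfl, rfl⟩ := h'
        simp [hs, orderSign, lowerNeg]
      · simp [h']
    · by_cases h2 : a = c ∧ b = d
      · obtain ⟨rfl, rfl⟩ := h2
        rcases lt_or_gt_of_ne h with h3 | h3 <;>
        simp [hs, orderSign, lowerNeg, h, h3, h3.le, h3.not_gt, h3.not_ge, h1, Ne.symm h]
      · by_cases h4 : b = c ∧ a = d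
        · obtain ⟨rfl, rfl⟩ := h4
          rcases lt_or_gt_of_ne h with h3 | h3 <;>
          simp [hs, orderSign, lowerNeg, h, h3, h3.le, h3.not_gt, h3.not_ge]
        · simp [h2, h4]
  have hM : flipDiagonal w = S * (Matrix.diagonal (lowerNeg w) * T) := by
    rw [← mul_assoc, ← hMS, mul_assoc, hST, mul_one]
  rw [hM, Matrix.charpoly_mul_comm, mul_assoc, mul_eq_one_comm.mp hST, mul_one]

theorem univ_prod_val_eq_diag_add_lt_add_swap :
    (Finset.univ : Finset (ι × ι)).val =
      Finset.univ.val.map (fun k : ι => (k, k))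
        + (Finset.univ.filter fun p : ι × ι => p.1 < p.2).val
        + (Finset.univ.filter fun p : ι × ι => p.1 < p.2).val.map Prod.swap := by
  refine (Multiset.Nodup.ext Finset.univ.nodup ?_).mpr ?_
  · refine Multiset.nodup_add.mpr ⟨Multiset.nodup_add.mpr ⟨?_, Finset.nodup _, ?_⟩, ?_, ?_⟩
    · exact Finset.univ.nodup.map fun a b h => congrArg Prod.fst h
    · rw [Multiset.disjoint_left]
      simp
    · exact (Finset.nodup _).map Prod.swap_injective
    · rw [Multiset.disjoint_left]
      rintro ⟨a, b⟩ h h'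
      simp only [Multiset.mem_add, Multiset.mem_map, Finset.mem_val, Finset.mem_univ, true_and,
        Finset.mem_filter, Prod.exists, Prod.mk.injEq, Prod.swap_prod_mk] at h h'
      grind
  · rintro ⟨a, b⟩
    simp only [Multiset.mem_add, Multiset.mem_map, Finset.mem_val, Finset.mem_univ, true_and,
      Finset.mem_filter, Prod.exists, Prod.mk.injEq, Prod.swap_prod_mk, true_iff]
    rcases lt_trichotomy a b with h | h | h
    · exact Or.inl (Or.inr h)
    · exact Or.inl (Or.inl ⟨a, rfl, h⟩)
    · exact Or.inr ⟨b, a, h, rfl, rfl⟩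

theorem map_lowerNeg_univ [Neg R] (w : ι × ι → R) (hw : ∀ p, w p.swap = w p) :
    Finset.univ.val.map (lowerNeg w) =
      (Finset.univ.val.map fun k : ι => w (k, k))
        + ((Finset.univ.filter fun p : ι × ι => p.1 < p.2).val.map w)
        + ((Finset.univ.filter fun p : ι × ι => p.1 < p.2).val.map fun p => -w p) := by
  rw [univ_prod_val_eq_diag_add_lt_add_swap, Multiset.map_add, Multiset.map_add,
    Multiset.map_map, Multiset.map_map]
  congr 1
  · congr 1
    · exact Multiset.map_congr rfl fun k _ => by simp [lowerNeg]
    · refine Multiset.map_congr rfl fun p hp => ?_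
      have : p.1 < p.2 := by simpa using hp
      simp [lowerNeg, this.le]
  · refine Multiset.map_congr rfl fun p hp => ?_
    have : p.1 < p.2 := by simpa using hp
    simp [lowerNeg, this.not_ge, hw]

theorem card_filter_fst_lt_snd :
    (Finset.univ.filter fun p : ι × ι => p.1 < p.2).card
      = Fintype.card ι * (Fintype.card ι - 1) / 2 := by
  have h := congrArg Multiset.card (univ_prod_val_eq_diag_add_lt_add_swap (ι := ι))
  simp only [Multiset.card_add, Multiset.card_map, Finset.card_val, Finset.card_univ,
    Fintype.card_prod] at h
  rw [Nat.mul_sub, mul_one]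
  omega

end SwapDiagonal

section Compression

variable {κ ι : Type*} [Fintype κ] [Fintype ι] [DecidableEq ι]

theorem card_le_card_of_conjTranspose_mul_self_eq_one {V : Matrix κ ι ℂ}
    (hV : V.conjTranspose * V = 1) : Fintype.card ι ≤ Fintype.card κ := by
  rw [← Matrix.rank_one (R := ℂ) (n := ι), ← hV]
  exact (Matrix.rank_mul_le_right _ _).trans (Matrix.rank_le_card_height _)

theorem Matrix.IsHermitian.map_eigenvalues_of_isometry_conj [DecidableEq κ] {A : Matrix κ κ ℂ}
    (hA : A.IsHermitian) {V : Matrix κ ι ℂ} (hV : V.conjTranspose * V = 1) {M : Matrix ι ι ℂ}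
    (hAM : A = V * M * V.conjTranspose) {d : ι → ℝ}
    (hM : M.charpoly = (Matrix.diagonal fun i => (d i : ℂ)).charpoly) :
    Finset.univ.val.map hA.eigenvalues =
      Finset.univ.val.map d + Multiset.replicate (Fintype.card κ - Fintype.card ι) 0 := by
  have hchar : A.charpoly = Polynomial.X ^ (Fintype.card κ - Fintype.card ι) *
      (Matrix.diagonal fun i => (d i : ℂ)).charpoly := by
    rw [hAM, Matrix.mul_assoc, Matrix.charpoly_mul_comm_of_le _ _
      (card_le_card_of_conjTranspose_mul_self_eq_one hV), Matrix.mul_assoc, hV, mul_one, hM]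
  have hroots : (Matrix.diagonal fun i => (d i : ℂ)).charpoly.roots =
      Finset.univ.val.map fun i => (d i : ℂ) := by
    rw [Matrix.charpoly_diagonal, Polynomial.roots_prod _ _
      (Finset.prod_ne_zero_iff.mpr fun i _ => Polynomial.X_sub_C_ne_zero _)]
    simp
  have h := congrArg Polynomial.roots hchar
  rw [hA.roots_charpoly_eq_eigenvalues, Polynomial.roots_mul
    (mul_ne_zero (pow_ne_zero _ Polynomial.X_ne_zero) (Matrix.charpoly_monic _).ne_zero),
    hroots, Polynomial.roots_pow, Polynomial.roots_X, Multiset.nsmul_singleton] at h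
  apply Multiset.map_injective Complex.ofReal_injective
  rw [Multiset.map_add, Multiset.map_map, Multiset.map_map, Multiset.map_replicate,
    Complex.ofReal_zero, add_comm]
  exact h

end Compression

theorem conjTranspose_mul_self_of_orthonormal {α β ι : Type*} [Fintype α] [Fintype β]
    [DecidableEq ι] {e : ι → α → ℂ} {f : ι → β → ℂ}
    (he : ∀ k l, ∑ i, star (e k i) * e l i = if k = l then 1 else 0)
    (hf : ∀ k l, ∑ μ, star (f k μ) * f l μ = if k = l then 1 else 0) :
    (Matrix.of fun (p : α × β) (q : ι × ι) => star (e q.1 p.1) * f q.2 p.2).conjTranspose *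
      (Matrix.of fun (p : α × β) (q : ι × ι) => star (e q.1 p.1) * f q.2 p.2) = 1 := by
  ext ⟨k, l⟩ ⟨k', l'⟩
  have h : (1 : Matrix (ι × ι) (ι × ι) ℂ) (k, l) (k', l') =
      (∑ i, star (e k' i) * e k i) * ∑ μ, star (f l μ) * f l' μ := by
    rw [he, hf, Matrix.one_apply]
    by_cases h₁ : k = k' <;> by_cases h₂ : l = l' <;> simp [h₁, h₂, eq_comm]
  rw [h, Finset.sum_mul_sum, Matrix.mul_apply, Fintype.sum_prod_type]
  refine Finset.sum_congr rfl fun i _ => Finset.sum_congr rfl fun μ _ => ?_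
  simp only [Matrix.conjTranspose_apply, Matrix.of_apply, star_mul', star_star]
  ring

/-- **Spectrum of the partial transpose of a pure state.** If `ψ` has Schmidt
decomposition `ψ(i,μ) = ∑_k λ_k e_k(i) f_k(μ)` with `r ≥ 1` strictly positive
Schmidt coefficients (`∑_k λ_k² = 1`) and orthonormal families `e`, `f`, then the
partial transpose `(ψψ†)^{T_A}` is Hermitian, its eigenvalues counted with
multiplicity are `λ_k²` (k = 1,…,r), `±λ_k λ_l` (k < l) and `0` with multiplicity
`mn − r²`; and if `r ≥ 2` it has exactly `r(r−1)/2` negative eigenvalues and is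
not positive semidefinite. -/
theorem partial_transpose_pure_state_spectrum (m n r : ℕ) (hr : 1 ≤ r)
    (lam : Fin r → ℝ) (hpos : ∀ k, 0 < lam k) (hsum : ∑ k, lam k ^ 2 = 1)
    (e : Fin r → Fin m → ℂ) (f : Fin r → Fin n → ℂ)
    (he : ∀ k l, ∑ i, star (e k i) * e l i = if k = l then 1 else 0)
    (hf : ∀ k l, ∑ μ, star (f k μ) * f l μ = if k = l then 1 else 0)
    (ψ : Fin m × Fin n → ℂ)
    (hψ : ∀ i μ, ψ (i, μ) = ∑ k, (lam k : ℂ) * e k i * f k μ)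
    (ρTA : Matrix (Fin m × Fin n) (Fin m × Fin n) ℂ)
    (hρTA : ∀ p q : Fin m × Fin n, ρTA p q = ψ (q.1, p.2) * star (ψ (p.1, q.2))) :
    ∃ hH : ρTA.IsHermitian,
      (Finset.univ.val.map hH.eigenvalues =
        (Finset.univ.val.map fun k : Fin r => lam k ^ 2)
          + ((Finset.univ.filter fun p : Fin r × Fin r => p.1 < p.2).val.map
              fun p => lam p.1 * lam p.2)
          + ((Finset.univ.filter fun p : Fin r × Fin r => p.1 < p.2).val.map
              fun p => -(lam p.1 * lam p.2))
          + Multiset.replicate (m * n - r ^ 2) (0 : ℝ)) ∧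
      (2 ≤ r →
        (Finset.univ.filter fun p : Fin m × Fin n => hH.eigenvalues p < 0).card
            = r * (r - 1) / 2
          ∧ ¬ ρTA.PosSemidef) := by
  set w : Fin r × Fin r → ℝ := fun p => lam p.1 * lam p.2 with hw
  have hws : ∀ p, w p.swap = w p := fun p => mul_comm _ _
  set V : Matrix (Fin m × Fin n) (Fin r × Fin r) ℂ :=
    Matrix.of fun p q => star (e q.1 p.1) * f q.2 p.2 with hVdef
  have hV : V.conjTranspose * V = 1 := conjTranspose_mul_self_of_orthonormal he hf
  have hH : ρTA.IsHermitian := by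
    ext p q
    rw [Matrix.conjTranspose_apply, hρTA, hρTA, star_mul', star_star, mul_comm]
  have hconj : ρTA = V * flipDiagonal (fun p => (w p : ℂ)) * V.conjTranspose := by
    ext p q
    have hflip : ∀ x, (V * flipDiagonal fun p => (w p : ℂ)) p x = V p x.swap * w x := by
      intro x
      rw [Matrix.mul_apply, Finset.sum_eq_single x.swap]
      · simp [flipDiagonal]
      · intro y _ hy
        have : y.swap ≠ x := fun h => hy (by rw [← h, Prod.swap_swap])
        simp [flipDiagonal, this]
      · simp
    rw [hρTA, hψ, hψ, star_sum, Finset.sum_mul_sum, Matrix.mul_apply, Fintype.sum_prod_type]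
    refine Finset.sum_congr rfl fun k _ => Finset.sum_congr rfl fun l _ => ?_
    rw [hflip]
    simp only [hVdef, hw, Matrix.conjTranspose_apply, Matrix.of_apply, star_mul',
      Prod.fst_swap, Prod.snd_swap, Complex.star_def, Complex.conj_conj, Complex.conj_ofReal, Complex.ofReal_mul]
    ring
  have hchar : (flipDiagonal fun p => (w p : ℂ)).charpoly =
      (Matrix.diagonal fun p => ((lowerNeg w p : ℝ) : ℂ)).charpoly := by
    rw [charpoly_flipDiagonal _ fun p => congrArg Complex.ofReal (hws p)]
    congr 2
    ext p
    simp only [lowerNeg]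
    split_ifs <;> simp
  have hspec := hH.map_eigenvalues_of_isometry_conj hV hconj hchar
  rw [map_lowerNeg_univ w hws] at hspec
  simp only [Fintype.card_prod, Fintype.card_fin, hw, ← pow_two] at hspec
  refine ⟨hH, hspec, fun hr2 => ?_⟩
  have hcard : (Finset.univ.filter fun p : Fin m × Fin n => hH.eigenvalues p < 0).card
      = r * (r - 1) / 2 := by
    have h := congrArg (Multiset.countP (· < 0)) hspec
    have hsq : ∀ k, ¬ lam k ^ 2 < 0 := fun k => (sq_nonneg _).not_gt
    have hwpos : ∀ k l, 0 < lam k * lam l := fun k l => mul_pos (hpos k) (hpos l)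
    simp only [Multiset.countP_add, Multiset.countP_map, hsq, (hwpos _ _).not_gt,
      neg_lt_zero, hwpos, Multiset.filter_false, Multiset.filter_true, Multiset.card_zero,
      zero_add] at h
    rw [Multiset.countP_eq_zero.mpr fun a ha => by simp [Multiset.eq_of_mem_replicate ha],
      add_zero, Finset.card_val, card_filter_fst_lt_snd, Fintype.card_fin] at h
    exact h
  refine ⟨hcard, fun hpsd => ?_⟩
  rw [Finset.filter_false_of_mem fun p _ => (hpsd.eigenvalues_nonneg p).not_gt,
    Finset.card_empty] at hcard
  have : 2 * 1 ≤ r * (r - 1) := Nat.mul_le_mul hr2 (by omega)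
  omega
end

section
/- The von Neumann entropy of a reduced state of a pure bipartite state is bounded by the logarithmic negativity: for any r ≥ 1 and strictly positive reals λ_1,…,λ_r with Σ_k λ_k² = 1 (the Schmidt coefficients of a bipartite pure state), one has −Σ_k λ_k² · log(λ_k²) ≤ log((Σ_k λ_k)²). -/
/-- **Entanglement entropy is bounded by the logarithmic negativity.** If
`λ_1,…,λ_r > 0` are the Schmidt coefficients of a bipartite pure state
(`∑_k λ_k² = 1`), then the von Neumann entropy of a reduced state,
`−∑_k λ_k² log(λ_k²)`, is at most the logarithmic negativity `log((∑_k λ_k)²)`. -/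
theorem entropy_le_log_negativity (r : ℕ) (hr : 1 ≤ r) (lam : Fin r → ℝ)
    (hpos : ∀ k, 0 < lam k) (hsum : ∑ k, lam k ^ 2 = 1) :
    -∑ k, lam k ^ 2 * Real.log (lam k ^ 2) ≤ Real.log ((∑ k, lam k) ^ 2) := by
  have jensen := strictConcaveOn_log_Ioi.concaveOn.le_map_sum (t := Finset.univ)
    (w := fun k => lam k ^ 2) (p := fun k => (lam k)⁻¹)
    (fun k _ => sq_nonneg (lam k)) hsum (fun k _ => inv_pos.mpr (hpos k))
  have hmean : ∑ k, lam k ^ 2 * (lam k)⁻¹ = ∑ k, lam k :=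
    Finset.sum_congr rfl fun k _ => by
      have := (hpos k).ne'
      field_simp
  simp only [smul_eq_mul, hmean, Real.log_inv, mul_neg, Finset.sum_neg_distrib] at jensen
  have hdouble : ∑ k, lam k ^ 2 * Real.log (lam k ^ 2) =
      2 * ∑ k, lam k ^ 2 * Real.log (lam k) := by
    rw [Finset.mul_sum]
    refine Finset.sum_congr rfl fun k _ => ?_
    rw [Real.log_pow]
    push_cast
    ring
  rw [hdouble, Real.log_pow]
  push_cast
  linarith
end

section
/- Rényi-entropy bound on truncation error: let λ : ℕ → ℝ be a nonincreasing sequence of nonnegative reals with Σ_{i≥1} λ_i = 1 (eigenvalues of a density matrix in nonincreasing order), let 0 < α < 1 be such that Σ_{i≥1} λ_i^α converges, set S_α = log(Σ_{i≥1} λ_i^α)/(1−α), and for D ≥ 1 set ε(D) = Σ_{i≥D+1} λ_i. If ε(D) > 0 then log(ε(D)) ≤ ((1−α)/α) · (S_α − log(D/(1−α))). -/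
/-- Splitting `∑ a_i ^ α` after the first `D` terms of a nonnegative sequence, where the first `D`
terms are at least `h` and the remaining ones at most `h`. -/
lemma head_add_tail_le_tsum_rpow {a : ℕ → ℝ} {α h : ℝ} {D : ℕ} (ha : ∀ i, 0 ≤ a i)
    (hs : Summable a) (hα0 : 0 < α) (hα1 : α < 1) (hconv : Summable fun i => a i ^ α)
    (hh : 0 < h) (head : ∀ i < D, h ≤ a i) (tail : ∀ i, a (i + D) ≤ h) :
    D * h ^ α + (∑' i, a (i + D)) * h ^ (α - 1) ≤ ∑' i, a i ^ α := by
  rw [← hconv.sum_add_tsum_nat_add D]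
  gcongr ?_ + ?_
  · calc (D : ℝ) * h ^ α = ∑ _i ∈ Finset.range D, h ^ α := by simp
      _ ≤ ∑ i ∈ Finset.range D, a i ^ α := Finset.sum_le_sum fun i hi =>
        Real.rpow_le_rpow hh.le (head i (Finset.mem_range.1 hi)) hα0.le
  · rw [← tsum_mul_right]
    refine Summable.tsum_le_tsum (fun i => ?_) (((summable_nat_add_iff D).2 hs).mul_right _)
      ((summable_nat_add_iff D).2 hconv)
    rcases (ha (i + D)).eq_or_lt with h0 | hpos
    · simp [← h0, hα0.ne']
    · calc a (i + D) * h ^ (α - 1) ≤ a (i + D) * a (i + D) ^ (α - 1) := by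
            exact mul_le_mul_of_nonneg_left
              (Real.rpow_le_rpow_of_nonpos hpos (tail i) (sub_nonpos.2 hα1.le)) hpos.le
        _ = a (i + D) ^ α := by
            rw [Real.rpow_sub_one hpos.ne', mul_div_cancel₀ _ hpos.ne']

/-- Weighted AM-GM in logarithmic form: the lower bound is independent of `h`. -/
lemma log_le_log_head_add_tail {α h d e : ℝ} (hα0 : 0 < α) (hα1 : α < 1) (hh : 0 < h)
    (hd : 0 < d) (he : 0 < e) :
    (1 - α) * Real.log (d / (1 - α)) + α * Real.log e ≤
      Real.log (d * h ^ α + e * h ^ (α - 1)) := by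
  have h1 : 0 < 1 - α := sub_pos.2 hα1
  have hA : 0 < d / (1 - α) * h ^ α := by positivity
  have hB : 0 < e * h ^ (α - 1) := by positivity
  have amgm := Real.geom_mean_le_arith_mean2_weighted h1.le hα0.le hA.le hB.le (by ring)
  have hle : (1 - α) * (d / (1 - α) * h ^ α) + α * (e * h ^ (α - 1)) ≤
      d * h ^ α + e * h ^ (α - 1) := by
    rw [← mul_assoc, mul_div_cancel₀ _ h1.ne']
    exact add_le_add_right (mul_le_of_le_one_left hB.le hα1.le) _
  refine le_trans (le_of_eq ?_) (Real.log_le_log (by positivity) (amgm.trans hle))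
  rw [Real.log_mul (by positivity) (by positivity), Real.log_rpow hA, Real.log_rpow hB,
    Real.log_mul (by positivity) (by positivity), Real.log_mul (by positivity) (by positivity),
    Real.log_rpow hh, Real.log_rpow hh]
  ring

/-- **Rényi-entropy bound on the truncation error.** Let `λ_1 ≥ λ_2 ≥ ⋯ ≥ 0` be a
nonincreasing sequence with `∑_{i≥1} λ_i = 1`, let `0 < α < 1` with
`∑_{i≥1} λ_i^α` convergent, set `S_α = log(∑_{i≥1} λ_i^α)/(1−α)` and
`ε(D) = ∑_{i≥D+1} λ_i`. Then for `D ≥ 1` with `ε(D) > 0` one has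
`log(ε(D)) ≤ ((1−α)/α)·(S_α − log(D/(1−α)))`. -/
theorem renyi_truncation_bound (lam : ℕ → ℝ)
    (hnonneg : ∀ i, 0 ≤ lam i)
    (hmono : ∀ i j, 1 ≤ i → i ≤ j → lam j ≤ lam i)
    (hsummable : Summable fun i : ℕ => lam (i + 1))
    (hsum : ∑' i : ℕ, lam (i + 1) = 1)
    (α : ℝ) (hα0 : 0 < α) (hα1 : α < 1)
    (hconv : Summable fun i : ℕ => lam (i + 1) ^ α)
    (D : ℕ) (hD : 1 ≤ D)
    (hε : 0 < ∑' i : ℕ, lam (i + D + 1)) :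
    Real.log (∑' i : ℕ, lam (i + D + 1)) ≤
      (1 - α) / α *
        (Real.log (∑' i : ℕ, lam (i + 1) ^ α) / (1 - α)
          - Real.log (D / (1 - α))) := by
  have h1 : 0 < 1 - α := sub_pos.2 hα1
  have hD' : (0 : ℝ) < D := by exact_mod_cast hD
  have hh : 0 < lam D := by
    refine (hnonneg D).lt_of_ne' fun h0 => hε.ne' ?_
    have hz : ∀ i, lam (i + D + 1) = 0 := fun i =>
      le_antisymm (h0 ▸ hmono D (i + D + 1) hD (by lia)) (hnonneg _)
    simp [hz]
  have hS := head_add_tail_le_tsum_rpow (a := fun i => lam (i + 1)) (D := D)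
    (fun i => hnonneg _) hsummable hα0 hα1 hconv hh
    (fun i hi => hmono _ _ (by lia) (by lia)) (fun i => hmono _ _ hD (by lia))
  have key := (log_le_log_head_add_tail hα0 hα1 hh hD' hε).trans
    (Real.log_le_log (by positivity) hS)
  rw [div_mul_eq_mul_div, le_div_iff₀ hα0, mul_sub, mul_div_cancel₀ _ h1.ne']
  linarith
end

section
/- CHSH classical bound (probability form): let Λ be a finite set, q : Λ → ℝ with q(λ) ≥ 0 and Σ_λ q(λ) = 1, and let a : Fin 2 × Λ → Fin 2 and b : Fin 2 × Λ → Fin 2 be deterministic response functions. For settings x_1, x_2 ∈ {1,2} define P(a_1 ⊕ a_2 = (x_1−1)(x_2−1) | x_1, x_2) = Σ_λ q(λ)·[a(x_1,λ) + b(x_2,λ) ≡ (x_1−1)(x_2−1) mod 2]. Then Σ_{x_1,x_2 ∈ {1,2}} P(a_1 ⊕ a_2 = (x_1−1)(x_2−1) | x_1, x_2) ≤ 3. -/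
/-- A deterministic strategy wins the CHSH game on at most three of the four pairs of settings. -/
theorem card_chsh_wins_le_three (f g : Fin 2 → Fin 2) :
    ∑ x₁ : Fin 2, ∑ x₂ : Fin 2,
      (if ((f x₁ : ℕ) + (g x₂ : ℕ)) % 2 = ((x₁ : ℕ) * (x₂ : ℕ)) % 2 then 1 else 0) ≤ 3 := by
  revert f g
  decide

/-- **CHSH classical bound (probability form).** For any local hidden-variable
model — a finite set `Λ` with probability weights `q` and deterministic binary
response functions `a, b : Fin 2 × Λ → Fin 2` (settings `x ∈ {1,2}` are encoded by
`x : Fin 2` with numerical value `x.val + 1`, so `(x₁−1)(x₂−1) = x₁.val * x₂.val`) —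
the sum over the four pairs of settings of the probabilities
`P(a₁ ⊕ a₂ = (x₁−1)(x₂−1) | x₁, x₂)` is at most `3`. -/
theorem chsh_classical_bound_probabilities (Λ : Type*) [Fintype Λ]
    (q : Λ → ℝ) (hq : ∀ lam, 0 ≤ q lam) (hq1 : ∑ lam, q lam = 1)
    (a b : Fin 2 × Λ → Fin 2) :
    ∑ x₁ : Fin 2, ∑ x₂ : Fin 2,
      (∑ lam, q lam *
        (if ((a (x₁, lam) : ℕ) + (b (x₂, lam) : ℕ)) % 2 = ((x₁ : ℕ) * (x₂ : ℕ)) % 2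
          then (1 : ℝ) else 0)) ≤ 3 := by
  have deterministic_bound (lam : Λ) :
      ∑ x₁ : Fin 2, ∑ x₂ : Fin 2,
        (if ((a (x₁, lam) : ℕ) + (b (x₂, lam) : ℕ)) % 2 = ((x₁ : ℕ) * (x₂ : ℕ)) % 2
          then (1 : ℝ) else 0) ≤ 3 := by
    exact_mod_cast card_chsh_wins_le_three (fun x => a (x, lam)) (fun x => b (x, lam))
  simp_rw [Finset.sum_comm (t := (Finset.univ : Finset Λ)), ← Finset.mul_sum]
  calc
    _ ≤ ∑ lam, q lam * 3 :=
      Finset.sum_le_sum fun lam _ => mul_le_mul_of_nonneg_left (deterministic_bound lam) (hq lam)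
    _ = 3 := by rw [← Finset.sum_mul, hq1, one_mul]
end

section
/- Classical bound for the three-parameter class of permutationally invariant two-body Bell inequalities: let n ≥ 1, let x, y be positive integers, σ ∈ {−1, +1}, s ∈ {−1, +1}, and μ ∈ ℤ such that μ and y have opposite parity if n is odd, and μ and x have opposite parity if n is even. Then for all functions m_0, m_1 : Fin n → {−1, +1}, writing S_0 = Σ_i m_0(i), S_1 = Σ_i m_1(i), S_00 = Σ_{i≠j} m_0(i)m_0(j), S_01 = Σ_{i≠j} m_0(i)m_1(j), S_11 = Σ_{i≠j} m_1(i)m_1(j) (sums over ordered pairs of distinct indices), one has x·(σμ + s(x+y))·S_0 + μy·S_1 + (x²/2)·S_00 + σxy·S_01 + (y²/2)·S_11 ≥ −(1/2)·(n(x+y)² + (σμ + sx)² − 1). -/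
/-- Symmetrized one-body correlator `S_k = ∑_i m_k(i)` of a deterministic local
strategy. -/
def oneBodySym (n : ℕ) (m : Fin n → ℤ) : ℝ := ∑ i, (m i : ℝ)

/-- Symmetrized two-body correlator `S_kl = ∑_{i≠j} m_k(i) m_l(j)` (sum over
ordered pairs of distinct indices) of a deterministic local strategy. -/
def twoBodySym (n : ℕ) (m m' : Fin n → ℤ) : ℝ :=
  ∑ i, ∑ j, if i = j then 0 else (m i : ℝ) * (m' j : ℝ)

/-- The off-diagonal double sum is the full product of sums minus the diagonal. -/
theorem twoBodySym_eq (n : ℕ) (m m' : Fin n → ℤ) :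
    twoBodySym n m m' = oneBodySym n m * oneBodySym n m' - ∑ i, (m i : ℝ) * (m' i : ℝ) := by
  unfold twoBodySym oneBodySym
  rw [Finset.sum_mul_sum, ← Finset.sum_sub_distrib]
  refine Finset.sum_congr rfl fun i _ => ?_
  rw [eq_sub_iff_add_eq, ← Finset.sum_erase_add _ _ (Finset.mem_univ i),
    ← Finset.sum_erase_add (a := i) _ (fun j => (m i : ℝ) * (m' j : ℝ)) (Finset.mem_univ i),
    if_pos rfl, add_zero]
  congr 1
  refine Finset.sum_congr rfl fun j hj => ?_
  rw [if_neg (Finset.ne_of_mem_erase hj).symm]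

/-- The diagonal part of a self-correlator of a `±1`-valued strategy equals `n`. -/
theorem twoBodySym_self (n : ℕ) (m : Fin n → ℤ) (hm : ∀ i, m i = 1 ∨ m i = -1) :
    twoBodySym n m m = oneBodySym n m ^ 2 - n := by
  have h : ∀ i, (m i : ℝ) * (m i : ℝ) = 1 := fun i => by
    rcases hm i with h | h <;> simp [h]
  simp [twoBodySym_eq, h, sq]

/-- A sum of `n` signs has the parity of `n`. -/
theorem exists_sum_sign_eq (n : ℕ) (m : Fin n → ℤ) (hm : ∀ i, m i = 1 ∨ m i = -1) :
    ∃ k : ℤ, ∑ i, m i = n + 2 * k := by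
  have h : (2 : ℤ) ∣ ∑ i, (m i - 1) := Finset.dvd_sum fun i _ => by
    rcases hm i with h | h <;> simp [h]
  obtain ⟨k, hk⟩ := h
  refine ⟨k, ?_⟩
  simp only [Finset.sum_sub_distrib, Finset.sum_const, Finset.card_univ, Fintype.card_fin,
    nsmul_eq_mul, mul_one] at hk
  linarith

/-- For signs, `∑ (1 + s m₀)(1 - σ s m₁)` is nonnegative, in expanded form. -/
theorem sign_correlation_nonneg (n : ℕ) (σ s : ℤ) (hσ : σ = 1 ∨ σ = -1) (hs : s = 1 ∨ s = -1)
    (m₀ m₁ : Fin n → ℤ)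
    (hm₀ : ∀ i, m₀ i = 1 ∨ m₀ i = -1) (hm₁ : ∀ i, m₁ i = 1 ∨ m₁ i = -1) :
    0 ≤ (n : ℝ) + s * oneBodySym n m₀ - σ * s * oneBodySym n m₁
      - σ * ∑ i, (m₀ i : ℝ) * (m₁ i : ℝ) := by
  have h : 0 ≤ ∑ i, (1 + (s : ℝ) * m₀ i - σ * s * m₁ i - σ * ((m₀ i : ℝ) * m₁ i)) :=
    Finset.sum_nonneg fun i _ => by
      rcases hσ with rfl | rfl <;> rcases hs with rfl | rfl <;>
        rcases hm₀ i with h₀ | h₀ <;> rcases hm₁ i with h₁ | h₁ <;> norm_num [h₀, h₁]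
  simpa [oneBodySym, Finset.sum_sub_distrib, Finset.sum_add_distrib, Finset.mul_sum] using h

/-- Under the parity hypotheses the integer `σ x S₀ + y S₁ + μ + σ s x` is odd. -/
theorem odd_shifted_sum (n x y : ℕ) (σ s : ℤ) (hσ : σ = 1 ∨ σ = -1) (hs : s = 1 ∨ s = -1)
    (μ : ℤ) (hparodd : Odd n → Odd (μ + (y : ℤ))) (hpareven : Even n → Odd (μ + (x : ℤ)))
    (m₀ m₁ : Fin n → ℤ)
    (hm₀ : ∀ i, m₀ i = 1 ∨ m₀ i = -1) (hm₁ : ∀ i, m₁ i = 1 ∨ m₁ i = -1) :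
    Odd (σ * x * ∑ i, m₀ i + y * ∑ i, m₁ i + μ + σ * s * x) := by
  obtain ⟨a, ha⟩ := exists_sum_sign_eq n m₀ hm₀
  obtain ⟨b, hb⟩ := exists_sum_sign_eq n m₁ hm₁
  have hσ' : ¬ Even σ := by rcases hσ with rfl | rfl <;> decide
  have hs' : ¬ Even s := by rcases hs with rfl | rfl <;> decide
  rw [ha, hb]
  simp only [← Int.not_even_iff_odd, ← Nat.not_even_iff_odd, Int.even_add, Int.even_mul,
    Int.even_coe_nat, even_two, true_or, iff_true, hσ', hs', false_or] at hparodd hpareven ⊢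
  clear ha hb hm₀ hm₁ hσ hs
  tauto

/-- **Classical bound for the three-parameter class of permutationally invariant
two-body Bell inequalities** of J. Tura et al., Science 344, 1256 (2014): for
positive integers `x, y`, signs `σ, s ∈ {−1,+1}` and `μ ∈ ℤ` of parity opposite
to `y` (odd `n`) resp. to `x` (even `n`), every deterministic local strategy
`m₀, m₁ : Fin n → {−1,+1}` satisfies
`x(σμ + s(x+y)) S₀ + μy S₁ + (x²/2) S₀₀ + σxy S₀₁ + (y²/2) S₁₁
  ≥ −(1/2)(n(x+y)² + (σμ + sx)² − 1)`. -/
theorem classical_bound_three_parameter_class (n : ℕ) (hn : 1 ≤ n)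
    (x y : ℕ) (hx : 0 < x) (hy : 0 < y)
    (σ s : ℤ) (hσ : σ = 1 ∨ σ = -1) (hs : s = 1 ∨ s = -1)
    (μ : ℤ)
    (hparodd : Odd n → Odd (μ + (y : ℤ)))
    (hpareven : Even n → Odd (μ + (x : ℤ)))
    (m₀ m₁ : Fin n → ℤ)
    (hm₀ : ∀ i, m₀ i = 1 ∨ m₀ i = -1) (hm₁ : ∀ i, m₁ i = 1 ∨ m₁ i = -1) :
    (x : ℝ) * ((σ : ℝ) * (μ : ℝ) + (s : ℝ) * ((x : ℝ) + (y : ℝ))) * oneBodySym n m₀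
        + (μ : ℝ) * (y : ℝ) * oneBodySym n m₁
        + (x : ℝ) ^ 2 / 2 * twoBodySym n m₀ m₀
        + (σ : ℝ) * (x : ℝ) * (y : ℝ) * twoBodySym n m₀ m₁
        + (y : ℝ) ^ 2 / 2 * twoBodySym n m₁ m₁
      ≥ -(1 / 2 * ((n : ℝ) * ((x : ℝ) + (y : ℝ)) ^ 2
          + ((σ : ℝ) * (μ : ℝ) + (s : ℝ) * (x : ℝ)) ^ 2 - 1)) := by
  have hA := odd_shifted_sum n x y σ s hσ hs μ hparodd hpareven m₀ m₁ hm₀ hm₁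
  have hP := sign_correlation_nonneg n σ s hσ hs m₀ m₁ hm₀ hm₁
  have hsq : (1 : ℝ) ≤ ((σ : ℝ) * x * oneBodySym n m₀ + y * oneBodySym n m₁
      + μ + σ * s * x) ^ 2 := by
    have hne := (sq_pos_of_ne_zero (fun h0 => by simp [h0] at hA :
      σ * x * ∑ i, m₀ i + y * ∑ i, m₁ i + μ + σ * s * x ≠ 0))
    have h1 := Int.add_one_le_iff.mpr hne
    rw [zero_add] at h1
    unfold oneBodySym
    exact_mod_cast h1
  have hxy := mul_nonneg (mul_nonneg (Nat.cast_nonneg (α := ℝ) x) (Nat.cast_nonneg y)) hP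
  rw [twoBodySym_self n m₀ hm₀, twoBodySym_self n m₁ hm₁, twoBodySym_eq n m₀ m₁]
  rcases hσ with rfl | rfl <;> rcases hs with rfl | rfl <;> push_cast at * <;> nlinarith
end
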